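/- arXiv:1808.03044 — 2 statements merged into one kernel-verified Lean document; each statement's English description precedes it below -/
import Mathlib

section
/- Let L > 0, ε > 0, and let f : ℝ → ℝ be Lipschitz continuous, positive, and L-periodic, and let q ∈ ℝ \ {0} satisfy 1/|q| ∈ [min f, max f]. Then every differentiable solution y : [0, T] → ℝ of y'(t) = f((y(t) − t)/ε)·|q| satisfies |y(T) − y(0) − T| ≤ ε·L. (In particular the average free-boundary speed over [0, T] differs from 1 by at most εL/T: the speed is pinned to 1.) -/
open Set in
/-- A solution of a scalar autonomous ODE with Lipschitz right-hand side that passes through an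
equilibrium stays there. -/
theorem eq_equilibrium_of_hits {v z : ℝ → ℝ} {K : NNReal} {a b s w : ℝ}
    (hv : LipschitzWith K v)
    (hz : ∀ t ∈ Icc a b, HasDerivWithinAt z (v (z t)) (Icc a b) t)
    (hw : v w = 0) (hs : s ∈ Icc a b) (hzs : z s = w) : z b = w := by
  have hsub : Icc s b ⊆ Icc a b := Icc_subset_Icc_left hs.1
  have hunique : EqOn z (fun _ ↦ w) (Icc s b) := by
    refine ODE_solution_unique (v := fun _ ↦ v) (fun _ ↦ hv)
      (fun t ht ↦ (hz t (hsub ht)).continuousWithinAt.mono hsub) (fun t ht ↦ ?_)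
      continuousOn_const (fun t _ ↦ ?_) hzs
    · exact (hz t (hsub (Ico_subset_Icc_self ht))).mono_of_mem_nhdsWithin
        (Icc_mem_nhdsGE_of_mem ⟨hs.1.trans ht.1, ht.2⟩)
    · simpa [hw] using hasDerivWithinAt_const t (Ici t) w
  exact hunique (right_mem_Icc.2 hs.2)

open Set in
/-- A solution of a scalar autonomous ODE with Lipschitz right-hand side cannot leave an interval
bounded by two equilibria. -/
theorem mem_Icc_of_equilibria {v z : ℝ → ℝ} {K : NNReal} {a b l u : ℝ} (hab : a ≤ b)
    (hv : LipschitzWith K v)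
    (hz : ∀ t ∈ Icc a b, HasDerivWithinAt z (v (z t)) (Icc a b) t)
    (hl : v l = 0) (hu : v u = 0) (ha : z a ∈ Icc l u) : z b ∈ Icc l u := by
  have hcont : ContinuousOn z (Icc a b) := fun t ht ↦ (hz t ht).continuousWithinAt
  constructor
  · by_contra! hlt
    obtain ⟨s, hs, hzs⟩ := intermediate_value_Icc' hab hcont ⟨hlt.le, ha.1⟩
    exact hlt.ne (eq_equilibrium_of_hits hv hz hl hs hzs)
  · by_contra! hlt
    obtain ⟨s, hs, hzs⟩ := intermediate_value_Icc hab hcont ⟨ha.2, hlt.le⟩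
    exact hlt.ne' (eq_equilibrium_of_hits hv hz hu hs hzs)

open Set in
/-- A continuous periodic real function attains every value between its infimum and supremum. -/
theorem Function.Periodic.Icc_sInf_sSup_subset_range {f : ℝ → ℝ} {L : ℝ}
    (hper : Function.Periodic f L) (hL : L ≠ 0) (hf : Continuous f) :
    Icc (sInf (range f)) (sSup (range f)) ⊆ range f := by
  have hcomp : IsCompact (range f) := hper.compact_of_continuous hL hf
  exact (isPreconnected_range hf).Icc_subset (hcomp.sInf_mem (range_nonempty f))
    (hcomp.sSup_mem (range_nonempty f))


/-- Quantitative pinning: with `f` Lipschitz, positive, `L`-periodic and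
`1/|q| ∈ [min f, max f]`, every solution of `y' = f((y - t)/ε)·|q|` on `[0,T]`
satisfies `|y(T) - y(0) - T| ≤ ε L`. -/
theorem stmt2 (L ε T : ℝ) (hL : 0 < L) (hε : 0 < ε) (hT : 0 ≤ T)
    (f : ℝ → ℝ) (K : NNReal) (hlip : LipschitzWith K f) (hpos : ∀ x, 0 < f x)
    (hper : Function.Periodic f L) (q : ℝ) (hq : q ≠ 0)
    (hq' : 1 / |q| ∈ Set.Icc (sInf (Set.range f)) (sSup (Set.range f)))
    (y : ℝ → ℝ)
    (hy : ∀ t ∈ Set.Icc (0 : ℝ) T,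
      HasDerivWithinAt y (f ((y t - t) / ε) * |q|) (Set.Icc 0 T) t) :
    |y T - y 0 - T| ≤ ε * L := by
  obtain ⟨x₀, hx₀⟩ := hper.Icc_sInf_sSup_subset_range hL.ne' hlip.continuous hq'
  obtain ⟨u, hu, hfu⟩ := hper.exists_mem_Ico hL x₀ ((y 0 - 0) / ε)
  have hfu' : f u * |q| = 1 := by
    rw [← hfu, hx₀, one_div_mul_cancel (abs_pos.2 hq).ne']
  have hfl : f (u - L) * |q| = 1 := by rw [hper.sub_eq, hfu']
  have hv : LipschitzWith (K * (|q| / ε).toNNReal) fun x ↦ (f x * |q| - 1) / ε := by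
    refine LipschitzWith.of_dist_le_mul fun x x' ↦ ?_
    have hdiff : (f x * |q| - 1) / ε - (f x' * |q| - 1) / ε = (f x - f x') * (|q| / ε) := by ring
    have hc : 0 ≤ |q| / ε := by positivity
    rw [Real.dist_eq, hdiff, abs_mul, abs_of_nonneg hc, NNReal.coe_mul, Real.coe_toNNReal _ hc,
      mul_right_comm]
    exact mul_le_mul_of_nonneg_right (hlip.dist_le_mul x x') hc
  have hz : ∀ t ∈ Set.Icc (0 : ℝ) T, HasDerivWithinAt (fun t ↦ (y t - t) / ε)
      ((f ((y t - t) / ε) * |q| - 1) / ε) (Set.Icc 0 T) t := fun t ht ↦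
    ((hy t ht).sub (hasDerivWithinAt_id t _)).div_const ε
  have hmem := mem_Icc_of_equilibria (l := u - L) (u := u) hT hv hz (by simp [hfl])
    (by simp [hfu']) ⟨by linarith [hu.2], hu.1⟩
  have hdiff : y T - y 0 - T = ε * ((y T - T) / ε - (y 0 - 0) / ε) := by field_simp; ring
  rw [hdiff, abs_mul, abs_of_pos hε]
  refine mul_le_mul_of_nonneg_left (abs_le.2 ⟨?_, ?_⟩) hε.le
  · linarith [hmem.1, hu.1]
  · linarith [hmem.2, hu.2]
end

section
/- Let g : ℝ → ℝ be Lipschitz continuous, positive, and 1-periodic, let q ∈ ℝ \ {0}, and let y : [0, ∞) → ℝ be differentiable with y'(t) = g(y(t))·|q| for all t ≥ 0. Then y(T)/T converges, as T → ∞, to |q| / ⟨1/g⟩, where ⟨1/g⟩ = ∫₀^1 (1/g(x)) dx. -/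
/-- The primitive of a continuous `1`-periodic function stays within bounded distance of the
linear function whose slope is the mean of the function over a period. -/
lemma Function.Periodic.exists_abs_primitive_sub_mul_le {f : ℝ → ℝ} (hf : Function.Periodic f 1)
    (hc : Continuous f) :
    ∃ M, ∀ x, |(∫ s in (0 : ℝ)..x, f s) - (∫ s in (0 : ℝ)..1, f s) * x| ≤ M := by
  have hint : ∀ a b, IntervalIntegrable f MeasureTheory.volume a b :=
    fun a b => hc.intervalIntegrable a b
  have hper : Function.Periodic
      (fun x => (∫ s in (0 : ℝ)..x, f s) - (∫ s in (0 : ℝ)..1, f s) * x) 1 := by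
    intro x
    have h1 := intervalIntegral.integral_add_adjacent_intervals (hint 0 x) (hint x (x + 1))
    have h2 := hf.intervalIntegral_add_eq x 0
    rw [zero_add] at h2
    simp only
    rw [← h1, h2]
    ring
  have hcont : Continuous
      (fun x => (∫ s in (0 : ℝ)..x, f s) - (∫ s in (0 : ℝ)..1, f s) * x) :=
    (intervalIntegral.continuous_primitive hint 0).sub (continuous_const.mul continuous_id)
  obtain ⟨M, hM⟩ := (hper.isBounded_of_continuous one_ne_zero hcont).exists_norm_le
  exact ⟨M, fun x => hM _ ⟨x, rfl⟩⟩

/-- Separation of variables for the autonomous equation `y' = g(y) c` on `[0, ∞)`. -/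
lemma integral_one_div_eq_of_hasDerivWithinAt {g : ℝ → ℝ} (hg : Continuous g)
    (hne : ∀ x, g x ≠ 0) {c : ℝ} {y : ℝ → ℝ}
    (hy : ∀ t ∈ Set.Ici (0 : ℝ), HasDerivWithinAt y (g (y t) * c) (Set.Ici 0) t)
    {t : ℝ} (ht : 0 ≤ t) :
    ∫ s in (0 : ℝ)..y t, 1 / g s = (∫ s in (0 : ℝ)..y 0, 1 / g s) + c * t := by
  have hcont : Continuous fun x => 1 / g x := continuous_const.div hg hne
  have hder : ∀ r ∈ Set.Ici (0 : ℝ),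
      HasDerivWithinAt (fun r => (∫ s in (0 : ℝ)..y r, 1 / g s) - c * r) 0 (Set.Ici 0) r := by
    intro r hr
    have h := ((hcont.integral_hasStrictDerivAt 0 (y r)).hasDerivAt.comp_hasDerivWithinAt r
      (hy r hr)).sub ((hasDerivWithinAt_id r (Set.Ici 0)).const_mul c)
    refine h.congr_deriv ?_
    field_simp [hne (y r)]
    ring
  have h := constant_of_has_deriv_right_zero (a := 0) (b := t)
    (fun r hr => (hder r hr.1).continuousWithinAt.mono Set.Icc_subset_Ici_self)
    (fun r hr => (hder r hr.1).mono (Set.Ici_subset_Ici.2 hr.1)) t ⟨ht, le_rfl⟩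
  simp only [mul_zero, sub_zero] at h
  linarith

/-- A function at bounded distance from `c * T` has average speed `c`. -/
lemma tendsto_div_atTop_of_abs_sub_mul_le {u : ℝ → ℝ} {c C : ℝ}
    (h : ∀ T, 0 ≤ T → |u T - c * T| ≤ C) :
    Filter.Tendsto (fun T => u T / T) Filter.atTop (nhds c) := by
  rw [tendsto_iff_norm_sub_tendsto_zero]
  refine squeeze_zero' (Filter.Eventually.of_forall fun T => norm_nonneg _) ?_
    (Filter.Tendsto.const_div_atTop Filter.tendsto_id C)
  filter_upwards [Filter.eventually_gt_atTop 0] with T hT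
  have hdiv : u T / T - c = (u T - c * T) / T := by field_simp
  rw [hdiv, Real.norm_eq_abs, abs_div, abs_of_pos hT]
  exact div_le_div_of_nonneg_right (h T hT.le) hT.le

/-- Space-only coefficient: for `g` Lipschitz, positive and 1-periodic, every
solution of `y' = g(y)|q|` on `[0,∞)` has long-time average speed
`y(T)/T → |q| / ⟨1/g⟩` where `⟨1/g⟩ = ∫₀¹ dx/g(x)`. -/
theorem stmt10 (g : ℝ → ℝ) (K : NNReal) (hlip : LipschitzWith K g)
    (hpos : ∀ x, 0 < g x) (hper : Function.Periodic g 1)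
    (q : ℝ) (hq : q ≠ 0) (y : ℝ → ℝ)
    (hy : ∀ t ∈ Set.Ici (0 : ℝ),
      HasDerivWithinAt y (g (y t) * |q|) (Set.Ici 0) t) :
    Filter.Tendsto (fun T => y T / T) Filter.atTop
      (nhds (|q| / ∫ x in (0 : ℝ)..1, 1 / g x)) := by
  have hne : ∀ x, g x ≠ 0 := fun x => (hpos x).ne'
  have hcont : Continuous fun x => 1 / g x := continuous_const.div hlip.continuous hne
  have hperiodic : Function.Periodic (fun x => 1 / g x) 1 := fun x => by simp only [hper x]
  obtain ⟨M, hM⟩ := hperiodic.exists_abs_primitive_sub_mul_le hcont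
  have hA : 0 < ∫ x in (0 : ℝ)..1, 1 / g x :=
    intervalIntegral.intervalIntegral_pos_of_pos (hcont.intervalIntegrable 0 1)
      (fun x => one_div_pos.2 (hpos x)) one_pos
  set A := ∫ x in (0 : ℝ)..1, 1 / g x
  set G₀ := ∫ x in (0 : ℝ)..y 0, 1 / g x
  refine tendsto_div_atTop_of_abs_sub_mul_le (C := (|G₀| + M) / A) fun T hT => ?_
  have hdist := hM (y T)
  rw [integral_one_div_eq_of_hasDerivWithinAt hlip.continuous hne hy hT] at hdist
  have hsub : y T - |q| / A * T = (G₀ - (G₀ + |q| * T - A * y T)) / A := by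
    field_simp
    ring
  rw [hsub, abs_div, abs_of_pos hA]
  exact div_le_div_of_nonneg_right
    ((abs_sub _ _).trans (add_le_add le_rfl hdist)) hA.le
end
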